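/- Let δ_i, δ_j > 0 and let γ_i, γ_j ∈ (0, 1]. Then there exists a learning rate α > 0 such that α²(γ_i − γ_j)² + (α γ_i − δ_i)² + (α γ_j − δ_j)² < δ_i² + δ_j². That is, applying the DPO update on unsafe samples strictly decreases the squared output-difference norm ‖f(x_i) − f(x_j)‖² from its pre-trained value δ_i² + δ_j² for a suitable learning rate. -/

import Mathlib

/-- for δ_i, δ_j > 0 and γ_i, γ_j ∈ (0,1], there is a learning rate α > 0
for which the DPO update on unsafe samples strictly decreases the squared
output-difference norm below its pre-trained value δ_i² + δ_j². -/
theorem stmt_6 (δi δj γi γj : ℝ) (hδi : 0 < δi) (hδj : 0 < δj)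
    (hγi : γi ∈ Set.Ioc (0 : ℝ) 1) (hγj : γj ∈ Set.Ioc (0 : ℝ) 1) :
    ∃ α : ℝ, 0 < α ∧
      α ^ 2 * (γi - γj) ^ 2 + (α * γi - δi) ^ 2 + (α * γj - δj) ^ 2 < δi ^ 2 + δj ^ 2 := by
  obtain ⟨hi, -⟩ := hγi
  obtain ⟨hj, -⟩ := hγj
  have hA : 0 < (γi - γj) ^ 2 + γi ^ 2 + γj ^ 2 := by positivity
  have hB : 0 < γi * δi + γj * δj := by positivity
  -- The minimiser of the quadratic in the learning rate.
  obtain ⟨α, hα⟩ : ∃ α, α * ((γi - γj) ^ 2 + γi ^ 2 + γj ^ 2) = γi * δi + γj * δj :=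
    ⟨_, div_mul_cancel₀ _ hA.ne'⟩
  have hpos : 0 < α := pos_of_mul_pos_left (hα ▸ hB) hA.le
  refine ⟨α, hpos, ?_⟩
  linear_combination α * hα + mul_pos hpos hB
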